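/- arXiv:0906.4730 — 4 statements merged into one kernel-verified Lean document; each statement's English description precedes it below -/
import Mathlib

section
/- Let K be a commutative ring. For all P ∈ K[x₁,…,x_l], Q ∈ K[x₁,…,x_m], R ∈ K[x₁,…,xₙ] and all indices 1 ≤ i ≤ l, 1 ≤ j ≤ m, the partial compositions satisfy the sequential composition axiom: (P ∘ᵢ Q) ∘_{i-1+j} R = P ∘ᵢ (Q ∘ⱼ R) in K[x₁,…,x_{l+m+n-2}]. -/
open MvPolynomial

/-- The partial composition `P ∘ᵢ Q`:
`(P ∘ᵢ Q)(x₁,…,x_{n+m-1}) = P(x₁,…,x_{i-1}, xᵢ+⋯+x_{i+m-1}, x_{i+m},…,x_{n+m-1})·Q(xᵢ,…,x_{i+m-1})`. -/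
noncomputable def pcomp {K : Type*} [CommRing K] {n m : ℕ}
    (P : MvPolynomial (Fin n) K) (i : Fin n) (Q : MvPolynomial (Fin m) K) :
    MvPolynomial (Fin (n + m - 1)) K :=
  aeval (fun k : Fin n =>
      if h : k.val < i.val then
        X (⟨k.val, by have := k.isLt; have := i.isLt; omega⟩ : Fin (n + m - 1))
      else if h2 : k.val = i.val then
        ∑ t : Fin m,
          X (⟨i.val + t.val, by have := i.isLt; have := t.isLt; omega⟩ : Fin (n + m - 1))
      else
        X (⟨k.val + m - 1, by have := k.isLt; have := i.isLt; omega⟩ : Fin (n + m - 1))) P *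
  aeval (fun t : Fin m =>
      X (⟨i.val + t.val, by have := i.isLt; have := t.isLt; omega⟩ : Fin (n + m - 1))) Q

theorem sum_aux {A : Type*} [AddCommMonoid A] (g : ℕ → A) (m n j : ℕ) (hj : j < m) (hn : 1 ≤ n) :
    ∑ t : Fin m, (if t.val < j then g t.val else if t.val = j then ∑ s : Fin n, g (j + s.val)
      else g (t.val + n - 1)) = ∑ t : Fin (m + n - 1), g t.val := by
  obtain ⟨c, rfl⟩ : ∃ c, m = j + 1 + c := ⟨m - (j + 1), by omega⟩
  rw [Fin.sum_univ_eq_sum_range (fun t => if t < j then g t else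
    if t = j then ∑ s : Fin n, g (j + s.val) else g (t + n - 1)), Fin.sum_univ_eq_sum_range g,
    Fin.sum_univ_eq_sum_range (fun s => g (j + s)),
    show j + 1 + c + n - 1 = j + n + c by omega, Finset.sum_range_add, Finset.sum_range_succ,
    Finset.sum_range_add g (j + n), Finset.sum_range_add g j]
  congr 1
  · congr 1
    · refine Finset.sum_congr rfl fun x hx => ?_
      rw [if_pos (Finset.mem_range.1 hx)]
    · simp
  · refine Finset.sum_congr rfl fun x hx => ?_
    rw [if_neg (by omega), if_neg (by omega)]
    congr 1; omega

/-- The variable with natural-number index, zero out of range. -/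
noncomputable def yv (K : Type*) [CommRing K] (N : ℕ) (a : ℕ) : MvPolynomial (Fin N) K :=
  if h : a < N then X ⟨a, h⟩ else 0

theorem X_eq_yv (K : Type*) [CommRing K] (N : ℕ) (a : ℕ) (h : a < N) :
    (X ⟨a, h⟩ : MvPolynomial (Fin N) K) = yv K N a := by
  simp [yv, h]

theorem map_pcomp {K A : Type*} [CommRing K] [CommRing A] [Algebra K A] {n m : ℕ}
    (P : MvPolynomial (Fin n) K) (i : Fin n) (Q : MvPolynomial (Fin m) K)
    (f : MvPolynomial (Fin (n + m - 1)) K →ₐ[K] A) (g : ℕ → A)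
    (hg : ∀ a : Fin (n + m - 1), f (X a) = g a.val) :
    f (pcomp P i Q) = aeval (fun k : Fin n => if k.val < i.val then g k.val
      else if k.val = i.val then ∑ t : Fin m, g (i.val + t.val) else g (k.val + m - 1)) P *
      aeval (fun t : Fin m => g (i.val + t.val)) Q := by
  unfold pcomp
  rw [map_mul, comp_aeval_apply, comp_aeval_apply]
  congr 2
  · congr 1
    funext k
    split_ifs <;> simp [hg]
  · congr 1
    funext k
    simp [hg]

/-- sequential composition axiom (Axiom I) for the partial compositions
of polynomials: `(P ∘ᵢ Q) ∘_{i-1+j} R = P ∘ᵢ (Q ∘ⱼ R)` (here indices are 0-based, so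
the 1-based index `i-1+j` becomes `i.val + j.val`). -/
theorem stmt_4 {K : Type*} [CommRing K] {l m n : ℕ} (hm : 1 ≤ m) (hn : 1 ≤ n)
    (P : MvPolynomial (Fin l) K) (Q : MvPolynomial (Fin m) K) (R : MvPolynomial (Fin n) K)
    (i : Fin l) (j : Fin m) :
    pcomp (pcomp P i Q) ⟨i.val + j.val, by have := i.isLt; have := j.isLt; omega⟩ R =
      rename (finCongr (by have := i.isLt; omega))
        (pcomp P i (pcomp Q j R)) := by
  have hi := i.isLt
  have hj := j.isLt
  rw [map_pcomp P i (pcomp Q j R) _ (yv K (l + m - 1 + n - 1))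
    (by intro a; rw [rename_X, ← X_eq_yv]; rfl)]
  rw [map_pcomp Q j R _ (fun a => yv K (l + m - 1 + n - 1) (i.val + a))
    (by intro a; rw [aeval_X])]
  have h1 := map_pcomp (pcomp P i Q) ⟨i.val + j.val, by omega⟩ R (AlgHom.id K _)
    (yv K (l + m - 1 + n - 1)) (by intro a; rw [← X_eq_yv]; rfl)
  rw [AlgHom.id_apply] at h1
  rw [h1, map_pcomp P i Q _ (fun a => if a < i.val + j.val then yv K (l + m - 1 + n - 1) a
      else if a = i.val + j.val then
        ∑ t : Fin n, yv K (l + m - 1 + n - 1) (i.val + j.val + t.val)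
      else yv K (l + m - 1 + n - 1) (a + n - 1)) (by intro a; rw [aeval_X]), mul_assoc]
  generalize yv K (l + m - 1 + n - 1) = y
  have key : ∀ t : ℕ, (if i.val + t < i.val + j.val then y (i.val + t)
      else if i.val + t = i.val + j.val then ∑ s : Fin n, y (i.val + j.val + s.val)
      else y (i.val + t + n - 1)) = (if t < j.val then y (i.val + t)
      else if t = j.val then ∑ s : Fin n, y (i.val + (j.val + s.val))
      else y (i.val + (t + n - 1))) := by
    intro t
    simp only [add_lt_add_iff_left, add_right_inj, add_assoc]
    rw [show i.val + (t + n) - 1 = i.val + (t + n - 1) by omega]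
  simp only [key]
  refine congrArg₂ (· * ·) ?_ ?_
  · refine congrArg (fun f => aeval f P) ?_
    funext k
    rw [sum_aux (fun a => y (i.val + a)) m n j.val hj hn]
    split_ifs <;> first | rfl | omega | (congr 1; omega)
  · simp only [add_assoc]
end

section
/- Let K be a commutative ring. For all P ∈ K[x₁,…,x_l], Q ∈ K[x₁,…,x_m], R ∈ K[x₁,…,xₙ] and all indices 1 ≤ i < k ≤ l, the partial compositions satisfy the parallel composition axiom: (P ∘ᵢ Q) ∘_{k+m-1} R = (P ∘ₖ R) ∘ᵢ Q in K[x₁,…,x_{l+m+n-2}]. -/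
open MvPolynomial

theorem aeval_congr_fun {K S : Type*} [CommRing K] [CommRing S] [Algebra K S] {n : ℕ}
    {f g : Fin n → S} (P : MvPolynomial (Fin n) K) (h : ∀ j, f j = g j) :
    aeval f P = aeval g P := by
  rw [funext h]

theorem mul_congr_both {S : Type*} [Mul S] {a b c d : S} (h : a = b) (h' : c = d) :
    a * c = b * d := by
  rw [h, h']

/-- parallel composition axiom (Axiom II) for the partial compositions
of polynomials: `(P ∘ᵢ Q) ∘_{k+m-1} R = (P ∘ₖ R) ∘ᵢ Q` for `i < k` (indices 0-based,
so the 1-based index `k+m-1` becomes `k.val + m - 1`). -/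
theorem stmt_5 {K : Type*} [CommRing K] {l m n : ℕ} (hm : 1 ≤ m) (hn : 1 ≤ n)
    (P : MvPolynomial (Fin l) K) (Q : MvPolynomial (Fin m) K) (R : MvPolynomial (Fin n) K)
    (i k : Fin l) (hik : i < k) :
    pcomp (pcomp P i Q) ⟨k.val + m - 1, by have := k.isLt; omega⟩ R =
      rename (finCongr (by have := k.isLt; omega))
        (pcomp (pcomp P k R) ⟨i.val, by have := i.isLt; omega⟩ Q) := by
  have hik' : i.val < k.val := hik
  have hk := k.isLt
  unfold pcomp
  simp only [map_mul]
  simp only [← AlgHom.comp_apply, comp_aeval]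
  rw [mul_assoc, mul_assoc, mul_comm (aeval _ Q)]
  refine mul_congr_both ?_ (mul_congr_both ?_ ?_)
  · refine aeval_congr_fun P fun j => ?_
    have hj := j.isLt
    rcases lt_trichotomy j.val i.val with h | h | h
    · have h1 : j.val < k.val := by omega
      have h2 : j.val < k.val + m - 1 := by omega
      simp [h, h1, h2]
    · have h1 : i.val < k.val := by omega
      have h2 (t : Fin m) : i.val + t.val < k.val + m - 1 := by have := t.isLt; omega
      simp [h, h1, h2]
    · have h0 : ¬ j.val < i.val := by omega
      have h0' : ¬ j.val = i.val := by omega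
      rcases lt_trichotomy j.val k.val with h' | h' | h'
      · have h2 : j.val + m - 1 < k.val + m - 1 := by omega
        simp [h0, h0', h', h2]
      · have h3 (t : Fin n) : ¬ (k.val + t.val < i.val) := by omega
        have h4 (t : Fin n) : ¬ (k.val + t.val = i.val) := by omega
        have h5 : ¬ k.val < i.val := by omega
        have h6 : ¬ k.val = i.val := by omega
        simp [h', h3, h4, h5, h6]
        refine Finset.sum_congr rfl fun t _ => ?_
        congr 2
        omega
      · have h1 : ¬ j.val < k.val := by omega
        have h1' : ¬ j.val = k.val := by omega
        have h2 : ¬ j.val + m - 1 < k.val + m - 1 := by omega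
        have h2' : ¬ j.val + m - 1 = k.val + m - 1 := by omega
        have h3 : ¬ j.val + n - 1 < i.val := by omega
        have h3' : ¬ j.val + n - 1 = i.val := by omega
        simp [h0, h0', h1, h1', h2, h2', h3, h3']
        congr 2
        omega
  · refine aeval_congr_fun _ fun t => ?_
    have h3 : ¬ (k.val + t.val < i.val) := by omega
    have h4 : ¬ (k.val + t.val = i.val) := by omega
    simp [h3, h4]
    congr 2
    omega
  · refine aeval_congr_fun _ fun t => ?_
    have h2 : i.val + t.val < k.val + m - 1 := by have := t.isLt; omega
    simp [h2]
end

section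
/- Let R be a commutative ring and F ∈ R[x₁,x₂] an associative polynomial. For P ∈ R[x₁,…,xₙ], Q ∈ R[x₁,…,x_m] and 1 ≤ i ≤ n define the F-twisted partial composition (P ∘ᵢ Q)(x₁,…,x_{n+m-1}) := P(x₁,…,x_{i-1}, F_m(x_i,…,x_{i+m-1}), x_{i+m},…,x_{n+m-1}) · Q(x_i,…,x_{i+m-1}). Then these compositions satisfy both operad axioms: (I) (P ∘ᵢ Q) ∘_{i-1+j} S = P ∘ᵢ (Q ∘ⱼ S) for 1 ≤ i ≤ n, 1 ≤ j ≤ m, and (II) (P ∘ᵢ Q) ∘_{k+m-1} S = (P ∘ₖ S) ∘ᵢ Q for 1 ≤ i < k ≤ n. -/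
open MvPolynomial

/-- The `(n+1)`-ary iterate of a polynomial `F ∈ R[x₁,x₂]`:
`F₁(x₁) = x₁` and `Fₙ(x₁,…,xₙ) = F(F_{n-1}(x₁,…,x_{n-1}), xₙ)`
(here `fIter F n` is `F_{n+1}`). -/
noncomputable def fIter {R : Type*} [CommRing R] (F : MvPolynomial (Fin 2) R) :
    (n : ℕ) → MvPolynomial (Fin (n + 1)) R
  | 0 => X 0
  | n + 1 =>
      aeval ![rename Fin.castSucc (fIter F n), X (Fin.last (n + 1))] F

/-- The `F`-twisted partial composition
`(P ∘ᵢ Q)(x₁,…) = P(x₁,…,x_{i-1}, F_m(xᵢ,…,x_{i+m-1}), x_{i+m},…)·Q(xᵢ,…,x_{i+m-1})`,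
where `P` has arity `n+1` and `Q` has arity `m+1` (indices 0-based). -/
noncomputable def fpcomp {R : Type*} [CommRing R] (F : MvPolynomial (Fin 2) R) {n m : ℕ}
    (P : MvPolynomial (Fin (n + 1)) R) (i : Fin (n + 1))
    (Q : MvPolynomial (Fin (m + 1)) R) :
    MvPolynomial (Fin (n + m + 1)) R :=
  aeval (fun k : Fin (n + 1) =>
      if h : k.val < i.val then
        (X ⟨k.val, by have := k.isLt; omega⟩ : MvPolynomial (Fin (n + m + 1)) R)
      else if h2 : k.val = i.val then
        rename (fun t : Fin (m + 1) =>
          (⟨i.val + t.val, by have := i.isLt; have := t.isLt; omega⟩ : Fin (n + m + 1)))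
          (fIter F m)
      else X ⟨k.val + m, by have := k.isLt; omega⟩) P *
  aeval (fun t : Fin (m + 1) =>
      (X ⟨i.val + t.val, by have := i.isLt; have := t.isLt; omega⟩ :
        MvPolynomial (Fin (n + m + 1)) R)) Q

section Helpers

variable {R A : Type*} [CommRing R] [CommRing A] [Algebra R A]

/-- the binary operation induced by `F` on an algebra -/
noncomputable def fop (F : MvPolynomial (Fin 2) R) (a b : A) : A := aeval ![a, b] F

theorem map_fop {B : Type*} [CommRing B] [Algebra R B] (F : MvPolynomial (Fin 2) R)
    (φ : A →ₐ[R] B) (a b : A) : φ (fop F a b) = fop F (φ a) (φ b) := by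
  unfold fop
  rw [← AlgHom.comp_apply, comp_aeval]
  congr 2
  funext t
  fin_cases t <;> simp

/-- iterated operation along a window of a sequence -/
noncomputable def fwin (F : MvPolynomial (Fin 2) R) (g : ℕ → A) (s : ℕ) : ℕ → A
  | 0 => g s
  | n + 1 => fop F (fwin F g s n) (g (s + (n + 1)))

/-- substituted sequence -/
noncomputable def fsub (F : MvPolynomial (Fin 2) R) (g : ℕ → A) (i m : ℕ) (k : ℕ) : A :=
  if k < i then g k else if k = i then fwin F g i m else g (k + m)

theorem fwin_congr (F : MvPolynomial (Fin 2) R) (g g' : ℕ → A) (s s' n : ℕ)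
    (h : ∀ t ≤ n, g (s + t) = g' (s' + t)) : fwin F g s n = fwin F g' s' n := by
  induction n with
  | zero => simpa [fwin] using h 0 le_rfl
  | succ n ih =>
    simp only [fwin]
    rw [ih (fun t ht => h t (by omega)), h (n + 1) le_rfl]

theorem fop_assoc (F : MvPolynomial (Fin 2) R)
    (hF : aeval ![aeval ![(X 0 : MvPolynomial (Fin 3) R), X 1] F, X 2] F
        = aeval ![(X 0 : MvPolynomial (Fin 3) R), aeval ![(X 1 : MvPolynomial (Fin 3) R), X 2] F] F)
    (a b c : A) : fop F (fop F a b) c = fop F a (fop F b c) := by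
  have h : fop F (fop F (X 0 : MvPolynomial (Fin 3) R) (X 1)) (X 2)
      = fop F (X 0) (fop F (X 1) (X 2)) := hF
  have h2 := congrArg (aeval (R := R) ![a, b, c]) h
  simpa [map_fop] using h2

theorem fwin_split (F : MvPolynomial (Fin 2) R)
    (hA : ∀ a b c : A, fop F (fop F a b) c = fop F a (fop F b c))
    (g : ℕ → A) (s a b : ℕ) :
    fwin F g s (a + b + 1) = fop F (fwin F g s a) (fwin F g (s + (a + 1)) b) := by
  induction b with
  | zero => rfl
  | succ b ih =>
    have e : a + (b + 1) + 1 = (a + b + 1) + 1 := by omega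
    rw [e, fwin, ih, hA, fwin]
    congr 3
    omega

theorem fwin_fsub (F : MvPolynomial (Fin 2) R)
    (hA : ∀ a b c : A, fop F (fop F a b) c = fop F a (fop F b c))
    (g : ℕ → A) (i j m n : ℕ) (hj : j ≤ m) :
    fwin F (fsub F g (i + j) n) i m = fwin F g i (m + n) := by
  induction m with
  | zero =>
    obtain rfl : j = 0 := by omega
    simp [fwin, fsub]
  | succ m ih =>
    rcases Nat.lt_or_ge m j with h | h
    · obtain rfl : j = m + 1 := by omega
      have e : m + 1 + n = m + n + 1 := by omega
      rw [e, fwin_split F hA]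
      simp only [fwin]
      congr 1
      · apply fwin_congr
        intro t ht
        rw [fsub, if_pos (by omega)]
      · simp [fsub]
    · have e : m + 1 + n = (m + n) + 1 := by omega
      rw [e]
      simp only [fwin]
      rw [ih h, fsub, if_neg (by omega), if_neg (by omega)]
      congr 2
      omega

theorem aeval_fIter (F : MvPolynomial (Fin 2) R) (g : ℕ → A) (s n : ℕ) :
    aeval (fun t : Fin (n + 1) => g (s + t.val)) (fIter F n) = fwin F g s n := by
  induction n with
  | zero => simp [fIter, fwin]
  | succ n ih =>
    have := map_fop F (aeval (R := R) (fun t : Fin (n + 1 + 1) => g (s + t.val)))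
      (rename Fin.castSucc (fIter F n)) (X (Fin.last (n + 1)))
    rw [fwin, ← ih]
    refine this.trans ?_
    rw [aeval_rename, aeval_X]
    rfl

theorem aeval_fpcomp (F : MvPolynomial (Fin 2) R) {n m : ℕ}
    (P : MvPolynomial (Fin (n + 1)) R) (i : Fin (n + 1))
    (Q : MvPolynomial (Fin (m + 1)) R) (g : ℕ → A) :
    aeval (fun k : Fin (n + m + 1) => g k.val) (fpcomp F P i Q)
      = aeval (fun k : Fin (n + 1) => fsub F g i.val m k.val) P
        * aeval (fun t : Fin (m + 1) => g (i.val + t.val)) Q := by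
  unfold fpcomp
  rw [map_mul, ← AlgHom.comp_apply, ← AlgHom.comp_apply, comp_aeval, comp_aeval]
  congr 3
  · funext k
    unfold fsub
    split_ifs
    · simp
    · rw [aeval_rename, ← aeval_fIter]
      rfl
    · simp
  · funext t
    simp

/-- variables extended by zero -/
noncomputable def xseq (R : Type*) [CommRing R] (N : ℕ) (k : ℕ) : MvPolynomial (Fin N) R :=
  if h : k < N then X ⟨k, h⟩ else 0

theorem aeval_xseq (N : ℕ) (p : MvPolynomial (Fin N) R) :
    aeval (fun k : Fin N => xseq R N k.val) p = p := by
  have : (fun k : Fin N => xseq R N k.val) = X := by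
    funext k
    simp [xseq]
  rw [this, aeval_X_left_apply]

theorem eq_rename {N M : ℕ} (h : M = N) (p : MvPolynomial (Fin N) R) (q : MvPolynomial (Fin M) R)
    (H : ∀ g : ℕ → MvPolynomial (Fin N) R,
      aeval (fun k : Fin N => g k.val) p = aeval (fun k : Fin M => g k.val) q) :
    p = rename (finCongr h) q := by
  subst h
  have := H (xseq R M)
  rw [aeval_xseq, aeval_xseq] at this
  simpa using this

end Helpers

/-- for an associative polynomial `F`, the `F`-twisted partial
compositions satisfy both operad axioms: (I) sequential composition
`(P ∘ᵢ Q) ∘_{i-1+j} S = P ∘ᵢ (Q ∘ⱼ S)` and (II) parallel composition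
`(P ∘ᵢ Q) ∘_{k+m-1} S = (P ∘ₖ S) ∘ᵢ Q` for `i < k` (indices 0-based,
arities `l'+1`, `m'+1`, `n'+1`). -/
theorem stmt_17 {R : Type*} [CommRing R] (F : MvPolynomial (Fin 2) R)
    (hF : aeval ![aeval ![(X 0 : MvPolynomial (Fin 3) R), X 1] F, X 2] F
        = aeval ![(X 0 : MvPolynomial (Fin 3) R), aeval ![(X 1 : MvPolynomial (Fin 3) R), X 2] F] F) :
    (∀ (l' m' n' : ℕ) (P : MvPolynomial (Fin (l' + 1)) R)
        (Q : MvPolynomial (Fin (m' + 1)) R) (S : MvPolynomial (Fin (n' + 1)) R)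
        (i : Fin (l' + 1)) (j : Fin (m' + 1)),
      fpcomp F (fpcomp F P i Q)
          ⟨i.val + j.val, by have := i.isLt; have := j.isLt; omega⟩ S =
        rename (finCongr (by omega))
          (fpcomp F P i (fpcomp F Q j S))) ∧
    (∀ (l' m' n' : ℕ) (P : MvPolynomial (Fin (l' + 1)) R)
        (Q : MvPolynomial (Fin (m' + 1)) R) (S : MvPolynomial (Fin (n' + 1)) R)
        (i k : Fin (l' + 1)), i < k →
      fpcomp F (fpcomp F P i Q)
          ⟨k.val + m', by have := k.isLt; omega⟩ S =
        rename (finCongr (by omega))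
          (fpcomp F (fpcomp F P k S) ⟨i.val, by have := i.isLt; omega⟩ Q)) := by
  constructor
  · intro l m n P Q S i j
    apply eq_rename
    intro g
    have hA := fop_assoc (A := MvPolynomial (Fin (l + m + n + 1)) R) F hF
    rw [aeval_fpcomp, aeval_fpcomp, aeval_fpcomp,
      aeval_fpcomp F Q j S (fun t => g (i.val + t)), mul_assoc]
    have hj := j.isLt
    congr 3
    · congr 1
      funext k
      simp only [fsub]
      split_ifs <;> first | rfl | omega | skip
      · exact fwin_fsub F hA g i j m n (by omega)
      · congr 1
        omega
    · congr 1
      funext t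
      simp only [fsub]
      split_ifs <;> first | rfl | omega | skip
      · apply fwin_congr
        intro t ht
        congr 1
        omega
      · congr 1
        omega
    · congr 1
      funext t
      congr 1
      simp only
      omega
  · intro l m n P Q S i k hik
    apply eq_rename
    intro g
    have hik' : i.val < k.val := hik
    rw [aeval_fpcomp, aeval_fpcomp, aeval_fpcomp, aeval_fpcomp, mul_right_comm]
    congr 3
    · congr 2
      funext t
      simp only [fsub]
      split_ifs <;> first | rfl | omega | skip
      · apply fwin_congr
        intro t ht
        rw [fsub, if_pos (by omega)]
      · apply fwin_congr
        intro t ht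
        rw [fsub, if_neg (by omega), if_neg (by omega)]
        congr 1
        omega
      · congr 1
        omega
    · congr 1
      funext t
      simp only [fsub]
      rw [if_neg (by omega), if_neg (by omega)]
      congr 1
      omega
    · congr 1
      funext t
      simp only [fsub]
      rw [if_pos (by omega)]
end

section
/- Let K be a commutative ring. For noncommutative polynomials P ∈ K⟨x₁,…,x_l⟩, Q ∈ K⟨x₁,…,x_m⟩, S ∈ K⟨x₁,…,xₙ⟩ (elements of free associative algebras), and all indices 1 ≤ i ≤ l, 1 ≤ j ≤ m, the partial compositions satisfy the sequential (pre-shuffle) axiom: (P •ᵢ Q) •_{i-1+j} S = P •ᵢ (Q •ⱼ S) in K⟨x₁,…,x_{l+m+n-2}⟩. -/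
/-- The partial composition `P •ᵢ Q := σᵢ(P) · τᵢ(Q)` of noncommutative polynomials,
where `σᵢ` sends `x_k ↦ x_k` for `k < i`, `x_i ↦ x_i + ⋯ + x_{i+m-1}`,
`x_k ↦ x_{k+m-1}` for `k > i`, and `τᵢ` sends `x_k ↦ x_{k+i-1}` (indices 0-based). -/
noncomputable def ncomp {K : Type*} [CommRing K] {n m : ℕ}
    (P : FreeAlgebra K (Fin n)) (i : Fin n) (Q : FreeAlgebra K (Fin m)) :
    FreeAlgebra K (Fin (n + m - 1)) :=
  (FreeAlgebra.lift K (fun k : Fin n =>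
      if h : k.val < i.val then
        FreeAlgebra.ι K (⟨k.val, by have := k.isLt; have := i.isLt; omega⟩ : Fin (n + m - 1))
      else if h2 : k.val = i.val then
        ∑ t : Fin m,
          FreeAlgebra.ι K
            (⟨i.val + t.val, by have := i.isLt; have := t.isLt; omega⟩ : Fin (n + m - 1))
      else
        FreeAlgebra.ι K
          (⟨k.val + m - 1, by have := k.isLt; have := i.isLt; omega⟩ : Fin (n + m - 1)))) P *
  (FreeAlgebra.lift K (fun t : Fin m =>
      FreeAlgebra.ι K
        (⟨i.val + t.val, by have := i.isLt; have := t.isLt; omega⟩ : Fin (n + m - 1)))) Q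

theorem sum_split_aux {A : Type*} [AddCommMonoid A] (f : ℕ → A) (m n j : ℕ) (hj : j < m) :
    (∑ t ∈ Finset.range m, if t < j then f t else if t = j then
      ∑ s ∈ Finset.range n, f (j + s) else f (t + n - 1)) =
    ∑ u ∈ Finset.range (m + n - 1), f u := by
  obtain ⟨r, rfl⟩ : ∃ r, m = j + 1 + r := ⟨m - (j + 1), by omega⟩
  have e : j + 1 + r + n - 1 = j + n + r := by omega
  rw [e, Finset.sum_range_add, Finset.sum_range_succ, Finset.sum_range_add, Finset.sum_range_add]
  congr 1
  · congr 1
    · apply Finset.sum_congr rfl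
      intro t ht
      rw [if_pos (Finset.mem_range.1 ht)]
    · simp
  · apply Finset.sum_congr rfl
    intro t _
    rw [if_neg (by omega), if_neg (by omega)]
    congr 1
    omega

/-- Generators indexed by naturals, zero out of range. -/
noncomputable def XX (K : Type*) [CommRing K] (N : ℕ) (k : ℕ) : FreeAlgebra K (Fin N) :=
  if h : k < N then FreeAlgebra.ι K ⟨k, h⟩ else 0

theorem iota_eq_XX {K : Type*} [CommRing K] {N : ℕ} (k : ℕ) (h : k < N) :
    FreeAlgebra.ι K (⟨k, h⟩ : Fin N) = XX K N k := by
  simp [XX, h]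

theorem lift_XX {K : Type*} [CommRing K] {N : ℕ} {A : Type*} [Ring A] [Algebra K A]
    (f : Fin N → A) (k : ℕ) (h : k < N) :
    FreeAlgebra.lift K f (XX K N k) = f ⟨k, h⟩ := by
  simp [XX, h]

theorem ncomp_eq {K : Type*} [CommRing K] {n m : ℕ}
    (P : FreeAlgebra K (Fin n)) (i : Fin n) (Q : FreeAlgebra K (Fin m)) :
    ncomp P i Q = (FreeAlgebra.lift K (fun k : Fin n =>
      if k.val < i.val then XX K (n + m - 1) k.val
      else if k.val = i.val then ∑ t ∈ Finset.range m, XX K (n + m - 1) (i.val + t)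
      else XX K (n + m - 1) (k.val + m - 1))) P *
    (FreeAlgebra.lift K (fun t : Fin m => XX K (n + m - 1) (i.val + t.val))) Q := by
  simp only [ncomp, iota_eq_XX, dite_eq_ite,
    Fin.sum_univ_eq_sum_range (fun t => XX K (n + m - 1) (i.val + t))]

theorem lift_cast_XX {K : Type*} [CommRing K] {N M : ℕ} (e : N = M) (k : ℕ) :
    FreeAlgebra.lift K (fun k : Fin N => FreeAlgebra.ι K (Fin.cast e k)) (XX K N k)
      = XX K M k := by
  subst e
  by_cases h : k < N
  · rw [lift_XX _ k h]; exact iota_eq_XX k h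
  · simp [XX, h]

/-- the sequential (pre-shuffle) axiom
`(P •ᵢ Q) •_{i-1+j} S = P •ᵢ (Q •ⱼ S)` for partial compositions of noncommutative
polynomials (indices 0-based, so the 1-based `i-1+j` becomes `i.val + j.val`). -/
theorem stmt_18 {K : Type*} [CommRing K] {l m n : ℕ} (hm : 1 ≤ m) (hn : 1 ≤ n)
    (P : FreeAlgebra K (Fin l)) (Q : FreeAlgebra K (Fin m)) (S : FreeAlgebra K (Fin n))
    (i : Fin l) (j : Fin m) :
    ncomp (ncomp P i Q) ⟨i.val + j.val, by have := i.isLt; have := j.isLt; omega⟩ S =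
      (FreeAlgebra.lift K fun k : Fin (l + (m + n - 1) - 1) =>
          FreeAlgebra.ι K (Fin.cast (by have := i.isLt; omega) k))
        (ncomp P i (ncomp Q j S)) := by
  obtain ⟨i, hi⟩ := i
  obtain ⟨j, hj⟩ := j
  simp only [ncomp_eq, map_mul, ← mul_assoc]
  congr 1
  · congr 1
    · simp only [← AlgHom.comp_apply]
      congr 1
      ext ⟨k, hk⟩
      simp only [Function.comp_apply, AlgHom.comp_apply, FreeAlgebra.lift_ι_apply]
      rcases lt_trichotomy k i with h | h | h
      · simp only [if_pos h]
        rw [lift_cast_XX, lift_XX _ _ (by omega)]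
        simp only
        rw [if_pos (by omega)]
      · subst h
        simp only [lt_irrefl, if_false, if_true, map_sum, lift_cast_XX]
        rw [← sum_split_aux (fun u => XX K (l + m - 1 + n - 1) (k + u)) m n j hj]
        apply Finset.sum_congr rfl
        intro t ht
        have ht := Finset.mem_range.1 ht
        rw [lift_XX _ _ (by omega)]
        simp only [add_lt_add_iff_left, add_right_inj, add_assoc]
        congr 3
        omega
      · simp only [if_neg (show ¬ k < i by omega), if_neg (show ¬ k = i by omega)]
        rw [lift_cast_XX, lift_XX _ _ (by omega)]
        simp only
        rw [if_neg (by omega), if_neg (by omega)]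
        congr 1
        omega
    · simp only [← AlgHom.comp_apply]
      congr 1
      ext ⟨k, hk⟩
      simp only [Function.comp_apply, AlgHom.comp_apply, FreeAlgebra.lift_ι_apply]
      rw [lift_XX _ _ (by omega)]
      simp only [add_lt_add_iff_left, add_right_inj]
      split_ifs with h1 h2
      · rw [lift_XX _ _ (by omega), lift_cast_XX]
      · simp only [map_sum]
        apply Finset.sum_congr rfl
        intro t ht
        have ht := Finset.mem_range.1 ht
        rw [lift_XX _ _ (by omega), lift_cast_XX, add_assoc]
      · rw [lift_XX _ _ (by omega), lift_cast_XX]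
        congr 1
        simp only
        omega
  · simp only [← AlgHom.comp_apply]
    congr 1
    ext ⟨k, hk⟩
    simp only [Function.comp_apply, AlgHom.comp_apply, FreeAlgebra.lift_ι_apply]
    rw [lift_XX _ _ (by omega), lift_cast_XX, add_assoc]
end
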